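/- Let T = [A,B,C]_R be an I×J×K real tensor. Suppose the k-ranks satisfy k_A + k_B + k_C ≥ 2R + 2. Then the rank of T equals R and the CPD of T is unique. -/

import Mathlib

open scoped BigOperators

noncomputable section

/-- The k-rank of a matrix: the largest `k` such that every subset of `k` columns is
linearly independent. -/
noncomputable def kRank {α β : Type*} [Fintype α] [Fintype β] (A : Matrix α β ℝ) : ℕ :=
  sSup {k | k ≤ Fintype.card β ∧
    ∀ s : Finset β, s.card = k → LinearIndependent ℝ fun j : s => fun i : α => A i j.1}

/-- The `I × J × K` tensor `[A, B, C]_R` built from factor matrices `A`, `B`, `C`: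
`t i j k = ∑ r, A i r * B j r * C k r`. -/
def cpdTensor {I J K R : ℕ} (A : Matrix (Fin I) (Fin R) ℝ) (B : Matrix (Fin J) (Fin R) ℝ)
    (C : Matrix (Fin K) (Fin R) ℝ) : Fin I → Fin J → Fin K → ℝ :=
  fun i j k => ∑ r, A i r * B j r * C k r

/-- The rank of a third-order tensor: the minimal number of rank-1 terms whose sum is `T`. -/
noncomputable def tensorRank {I J K : ℕ} (T : Fin I → Fin J → Fin K → ℝ) : ℕ :=
  sInf {n | ∃ A B C, T = cpdTensor (R := n) A B C}

/-- Uniqueness of the CPD with `R` terms: any two representations of `T` as a sum of `R`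
rank-1 terms coincide up to a common permutation of the terms and scalings of the columns
whose product is `1` within each term. -/
def cpdUnique {I J K : ℕ} (R : ℕ) (T : Fin I → Fin J → Fin K → ℝ) : Prop :=
  ∀ (A A' : Matrix (Fin I) (Fin R) ℝ) (B B' : Matrix (Fin J) (Fin R) ℝ)
    (C C' : Matrix (Fin K) (Fin R) ℝ),
    T = cpdTensor A B C → T = cpdTensor A' B' C' →
    ∃ (σ : Equiv.Perm (Fin R)) (la lb lc : Fin R → ℝ),
      (∀ r, la r * lb r * lc r = 1) ∧
      (∀ i r, A' i r = la r * A i (σ r)) ∧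
      (∀ j r, B' j r = lb r * B j (σ r)) ∧
      (∀ k r, C' k r = lc r * C k (σ r))

/-- The outer product of a coordinate vector and a vector. -/
def outer {I W : Type*} [AddCommGroup W] [Module ℝ W] (x : I → ℝ) (w : W) : I → W :=
  fun i => x i • w

section Annihilator

variable {ι V : Type*} [AddCommGroup V] [Module ℝ V]

/-- Evaluation of linear functionals at the members of a finite family. -/
def evalOn (D : Finset ι) (x : ι → V) : Module.Dual ℝ V →ₗ[ℝ] (D → ℝ) where
  toFun φ b := φ (x b)
  map_add' _ _ := rfl
  map_smul' _ _ := rfl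

lemma finrank_map_evalOn_dualAnnihilator [FiniteDimensional ℝ V] (U : Submodule ℝ V)
    (D : Finset ι) (x : ι → V) :
    Module.finrank ℝ (U.dualAnnihilator.map (evalOn D x)) + Module.finrank ℝ U =
      Module.finrank ℝ ↥(U ⊔ Submodule.span ℝ (x '' D)) := by
  have h1 := Subspace.finrank_add_finrank_dualAnnihilator_eq U
  have h2 := Subspace.finrank_add_finrank_dualAnnihilator_eq (U ⊔ Submodule.span ℝ (x '' D))
  have h3 := LinearMap.finrank_range_add_finrank_ker (K := ℝ) (V := U.dualAnnihilator)
    ((evalOn D x).domRestrict U.dualAnnihilator)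
  rw [LinearMap.range_domRestrict] at h3
  have h4 : ((LinearMap.ker ((evalOn D x).domRestrict U.dualAnnihilator)).map
      U.dualAnnihilator.subtype) = (U ⊔ Submodule.span ℝ (x '' D)).dualAnnihilator := by
    ext φ
    rw [Submodule.dualAnnihilator_sup_eq]
    simp only [Submodule.mem_map, LinearMap.mem_ker, Submodule.mem_inf]
    constructor
    · rintro ⟨ψ, hψ, rfl⟩
      refine ⟨ψ.2, ?_⟩
      rw [Submodule.mem_dualAnnihilator]
      intro v hv
      induction hv using Submodule.span_induction with
      | mem v hv =>
        obtain ⟨b, hb, rfl⟩ := hv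
        exact congrFun hψ ⟨b, hb⟩
      | zero => simp
      | add u v _ _ hu hv => rw [map_add, hu, hv, add_zero]
      | smul a v _ hv => rw [map_smul, hv, smul_zero]
    · rintro ⟨h, h'⟩
      refine ⟨⟨φ, h⟩, ?_, rfl⟩
      ext b
      exact (Submodule.mem_dualAnnihilator φ).1 h' _ (Submodule.subset_span ⟨b, b.2, rfl⟩)
  rw [← h4, Submodule.finrank_map_subtype_eq] at h2
  omega

lemma finrank_add_finrank_le_of_dotProduct_eq_zero {D : Type*} [Fintype D]
    (P Q : Submodule ℝ (D → ℝ)) (h : ∀ u ∈ P, ∀ v ∈ Q, ∑ b, u b * v b = 0) :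
    Module.finrank ℝ P + Module.finrank ℝ Q ≤ Fintype.card D := by
  classical
  have h1 := Subspace.finrank_add_finrank_dualAnnihilator_eq P
  have h2 : Q.map (dotProductEquiv ℝ D).toLinearMap ≤ P.dualAnnihilator := by
    rintro _ ⟨v, hv, rfl⟩
    rw [Submodule.mem_dualAnnihilator]
    intro u hu
    simpa [dotProduct, mul_comm] using h u hu v hv
  have h3 := Submodule.finrank_mono h2
  rw [LinearEquiv.finrank_map_eq] at h3
  rw [Module.finrank_fintype_fun_eq_card] at h1
  omega

end Annihilator

section Outer

variable {ι I W : Type*} [AddCommGroup W] [Module ℝ W]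

/-- The linear functional `φ ⊗ ψ` on `W`-valued coordinate vectors. -/
def dualPairing (φ : Module.Dual ℝ (I → ℝ)) (ψ : Module.Dual ℝ W) : Module.Dual ℝ (I → W) :=
  φ ∘ₗ ψ.compLeft I

lemma dualPairing_outer (φ : Module.Dual ℝ (I → ℝ)) (ψ : Module.Dual ℝ W) (x : I → ℝ) (w : W) :
    dualPairing φ ψ (outer x w) = φ x * ψ w := by
  have : ψ.compLeft I (outer x w) = ψ w • x := by
    ext i
    simp [outer, mul_comm]
  rw [dualPairing, LinearMap.comp_apply, this, map_smul, smul_eq_mul, mul_comm]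

lemma exists_dualPairing_ne_zero {f : I → W} (hf : f ≠ 0) :
    ∃ φ ψ, dualPairing φ ψ f ≠ 0 := by
  obtain ⟨i, hi⟩ := Function.ne_iff.1 hf
  obtain ⟨ψ, hψ⟩ := not_forall.1 (mt (Module.forall_dual_apply_eq_zero_iff ℝ (f i)).1 hi)
  exact ⟨LinearMap.proj i, ψ, hψ⟩

lemma dualPairing_eq_zero {x : ι → I → ℝ} {w : ι → W} {F : Set ι} {f : I → W}
    (hf : f ∈ Submodule.span ℝ ((fun a => outer (x a) (w a)) '' F))
    {φ : Module.Dual ℝ (I → ℝ)} {ψ : Module.Dual ℝ W}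
    (h : ∀ a ∈ F, φ (x a) * ψ (w a) = 0) : dualPairing φ ψ f = 0 := by
  induction hf using Submodule.span_induction with
  | mem v hv =>
    obtain ⟨a, ha, rfl⟩ := hv
    rw [dualPairing_outer, h a ha]
  | zero => rw [map_zero]
  | add u v _ _ hu hv => rw [map_add, hu, hv, add_zero]
  | smul r v _ hv => rw [map_smul, hv, smul_zero]

lemma finrank_sup_add_finrank_sup_le [Fintype I] [FiniteDimensional ℝ W] (x : ι → I → ℝ)
    (w : ι → W) (F : Set ι) (D : Finset ι) (c : ι → ℝ) (hc : ∀ b ∈ D, c b ≠ 0)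
    (hf : ∑ b ∈ D, c b • outer (x b) (w b) ∈
      Submodule.span ℝ ((fun a => outer (x a) (w a)) '' F))
    (hf0 : ∑ b ∈ D, c b • outer (x b) (w b) ≠ 0) :
    Module.finrank ℝ ↥(Submodule.span ℝ (x '' F) ⊔ Submodule.span ℝ (x '' D)) +
      Module.finrank ℝ ↥(Submodule.span ℝ (w '' F) ⊔ Submodule.span ℝ (w '' D)) + 1 ≤
    Module.finrank ℝ (Submodule.span ℝ (x '' F)) +
      Module.finrank ℝ (Submodule.span ℝ (w '' F)) + D.card := by
  have hspan : Submodule.span ℝ (w '' D) ≤ Submodule.span ℝ ((fun b => c b • w b) '' D) := by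
    rw [Submodule.span_le]
    rintro _ ⟨b, hb, rfl⟩
    have := Submodule.smul_mem _ (c b)⁻¹ (Submodule.subset_span (R := ℝ)
      (Set.mem_image_of_mem (fun b => c b • w b) hb))
    simpa [smul_smul, inv_mul_cancel₀ (hc b hb)] using this
  set P := (Submodule.span ℝ (x '' F)).dualAnnihilator.map (evalOn D x)
  set Q := (Submodule.span ℝ (w '' F)).dualAnnihilator.map (evalOn D fun b => c b • w b)
  set Q' := (⊥ : Submodule ℝ W).dualAnnihilator.map (evalOn D fun b => c b • w b) with hQ'
  have hP : Module.finrank ℝ P + _ = _ :=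
    finrank_map_evalOn_dualAnnihilator (Submodule.span ℝ (x '' F)) D x
  have hQ : Module.finrank ℝ Q + _ = _ :=
    finrank_map_evalOn_dualAnnihilator (Submodule.span ℝ (w '' F)) D (fun b => c b • w b)
  have hsum : ∀ (φ : Module.Dual ℝ (I → ℝ)) (ψ : Module.Dual ℝ W),
      ∑ b, evalOn D x φ b * evalOn D (fun b => c b • w b) ψ b =
      dualPairing φ ψ (∑ b ∈ D, c b • outer (x b) (w b)) := by
    intro φ ψ
    rw [map_sum, ← Finset.sum_coe_sort D]
    refine Finset.sum_congr rfl fun b _ => ?_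
    rw [map_smul, dualPairing_outer]
    change φ (x b) * ψ (c b • w b) = _
    rw [map_smul, smul_eq_mul, smul_eq_mul]
    ring
  have hPQ' : ∀ u ∈ P, ∀ v ∈ Q', ∑ b, u b * v b = 0 := by
    rintro _ ⟨φ, hφ, rfl⟩ _ ⟨ψ, -, rfl⟩
    rw [hsum]
    refine dualPairing_eq_zero hf fun a ha => ?_
    rw [(Submodule.mem_dualAnnihilator φ).1 hφ _ (Submodule.subset_span ⟨a, ha, rfl⟩), zero_mul]
  have hle : Q ≤ Q' := Submodule.map_mono (by simp)
  have hlt : Q < Q' := by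
    refine lt_of_le_of_ne hle fun heq => ?_
    obtain ⟨φ, ψ, hne⟩ := exists_dualPairing_ne_zero hf0
    refine hne ?_
    have hmem : evalOn D (fun b => c b • w b) ψ ∈ Q := by
      rw [heq, hQ']
      exact Submodule.mem_map_of_mem (by simp)
    obtain ⟨χ, hχ, hχψ⟩ := hmem
    rw [← hsum, ← hχψ, hsum]
    refine dualPairing_eq_zero hf fun a ha => ?_
    rw [(Submodule.mem_dualAnnihilator χ).1 hχ _ (Submodule.subset_span ⟨a, ha, rfl⟩), mul_zero]
  have h1 := finrank_add_finrank_le_of_dotProduct_eq_zero P Q' hPQ'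
  have h2 := Submodule.finrank_lt_finrank_of_lt hlt
  have h3 := Submodule.finrank_mono (sup_le_sup_left hspan (Submodule.span ℝ (w '' F)))
  rw [Fintype.card_coe] at h1
  omega

end Outer

section Connected

variable {ι U I W : Type*} [AddCommGroup U] [Module ℝ U] [AddCommGroup W] [Module ℝ W]

open Classical in
/-- A finite family of vectors is connected if its span is not the direct sum of the spans of
two complementary nonempty subfamilies. -/
def ConnectedOn (t : ι → U) (P : Finset ι) : Prop :=
  ∀ F ⊆ P, F.Nonempty → F ≠ P →
    ¬ Disjoint (Submodule.span ℝ (t '' F)) (Submodule.span ℝ (t '' ↑(P \ F)))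

lemma exists_ear [FiniteDimensional ℝ U] (t : ι → U) (S T : Finset ι)
    (h : ¬ Disjoint (Submodule.span ℝ (t '' S)) (Submodule.span ℝ (t '' T))) :
    ∃ D ⊆ T, D.Nonempty ∧ ∃ c : ι → ℝ, (∀ b ∈ D, c b ≠ 0) ∧
      ∑ b ∈ D, c b • t b ∈ Submodule.span ℝ (t '' S) ∧ ∑ b ∈ D, c b • t b ≠ 0 ∧
      Module.finrank ℝ (Submodule.span ℝ (t '' S)) + D.card ≤
        Module.finrank ℝ ↥(Submodule.span ℝ (t '' S) ⊔ Submodule.span ℝ (t '' D)) + 1 := by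
  classical
  obtain ⟨D, hDT, hD, hmin⟩ := exists_minimal_le_of_wellFoundedLT
    (fun D : Finset ι => ¬ Disjoint (Submodule.span ℝ (t '' S)) (Submodule.span ℝ (t '' D))) T h
  have herase : ∀ b ∈ D,
      Disjoint (Submodule.span ℝ (t '' S)) (Submodule.span ℝ (t '' ↑(D.erase b))) := by
    intro b hb
    by_contra hcon
    exact Finset.notMem_erase b D (hmin hcon (Finset.erase_subset b D) hb)
  obtain ⟨f, hfS, hfD, hf0⟩ : ∃ f ∈ Submodule.span ℝ (t '' S),
      f ∈ Submodule.span ℝ (t '' D) ∧ f ≠ 0 := by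
    simpa [Submodule.disjoint_def] using hD
  obtain ⟨c, rfl⟩ : ∃ c : ι → ℝ, ∑ b ∈ D, c b • t b = f := by
    obtain ⟨c, rfl⟩ := (Submodule.mem_span_image_finset_iff_exists_fun ℝ).1 hfD
    refine ⟨fun b => if h : b ∈ D then c ⟨b, h⟩ else 0, ?_⟩
    rw [← Finset.sum_coe_sort D]
    simp
  have hne : D.Nonempty := by
    rw [Finset.nonempty_iff_ne_empty]
    rintro rfl
    simp at hf0
  refine ⟨D, hDT, hne, c, fun b hb hcb => ?_, hfS, hf0, ?_⟩
  · refine hf0 (Submodule.disjoint_def.1 (herase b hb) _ hfS ?_)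
    rw [← Finset.add_sum_erase D _ hb, hcb, zero_smul, zero_add]
    exact Submodule.sum_mem _ fun a ha =>
      Submodule.smul_mem _ _ (Submodule.subset_span ⟨a, ha, rfl⟩)
  · have hind : LinearIndepOn ℝ t (D : Set ι) := by
      rw [linearIndepOn_iff_notMem_span]
      intro b hb hmem
      refine hD ((herase b hb).mono_right ?_)
      rw [Submodule.span_le]
      rintro _ ⟨a, ha, rfl⟩
      rcases eq_or_ne a b with rfl | hab
      · simpa using hmem
      · exact Submodule.subset_span ⟨a, by simpa using ⟨ha, hab⟩, rfl⟩
    obtain ⟨b, hb⟩ := hne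
    have hind' : LinearIndepOn ℝ t (↑(D.erase b) : Set ι) :=
      hind.mono (by simp)
    have hcard : Module.finrank ℝ (Submodule.span ℝ (t '' ↑(D.erase b))) = (D.erase b).card := by
      have := finrank_span_eq_card hind'
      rw [← Set.image_eq_range] at this
      exact this.trans (Fintype.card_coe _)
    have h1 := Submodule.finrank_sup_add_finrank_inf_eq (Submodule.span ℝ (t '' S))
      (Submodule.span ℝ (t '' ↑(D.erase b)))
    rw [(herase b hb).eq_bot, finrank_bot, hcard, Finset.card_erase_of_mem hb] at h1
    have h2 : Module.finrank ℝ ↥(Submodule.span ℝ (t '' S) ⊔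
        Submodule.span ℝ (t '' ↑(D.erase b))) ≤
        Module.finrank ℝ ↥(Submodule.span ℝ (t '' S) ⊔ Submodule.span ℝ (t '' D)) :=
      Submodule.finrank_mono (sup_le_sup_left (Submodule.span_mono
        (Set.image_mono (by simp))) _)
    omega

/-- The dimension bound for connected families of product vectors. -/
lemma ConnectedOn.finrank_add_finrank_le [Fintype I] [FiniteDimensional ℝ W] {x : ι → I → ℝ}
    {w : ι → W} {P : Finset ι} (hP : ConnectedOn (fun a => outer (x a) (w a)) P)
    (hne : P.Nonempty) (h0 : ∀ a ∈ P, outer (x a) (w a) ≠ 0) :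
    Module.finrank ℝ (Submodule.span ℝ (x '' P)) +
      Module.finrank ℝ (Submodule.span ℝ (w '' P)) ≤
    Module.finrank ℝ (Submodule.span ℝ ((fun a => outer (x a) (w a)) '' P)) + 1 := by
  classical
  set t : ι → I → W := fun a => outer (x a) (w a)
  obtain ⟨a, ha⟩ := hne
  let s : Set (Finset ι) := {F | F ⊆ P ∧ F.Nonempty ∧
    Module.finrank ℝ (Submodule.span ℝ (x '' F)) +
      Module.finrank ℝ (Submodule.span ℝ (w '' F)) ≤
    Module.finrank ℝ (Submodule.span ℝ (t '' F)) + 1}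
  have hs : s.Finite := (Finset.finite_toSet P.powerset).subset fun F hF => by
    simpa using hF.1
  have has : {a} ∈ s := by
    refine ⟨by simpa using ha, by simp, ?_⟩
    have h1 := finrank_span_le_card (R := ℝ) ({x a} : Set (I → ℝ))
    have h2 := finrank_span_le_card (R := ℝ) ({w a} : Set W)
    have h3 : Module.finrank ℝ (Submodule.span ℝ {t a}) = 1 := finrank_span_singleton (h0 a ha)
    rw [Set.toFinset_singleton, Finset.card_singleton] at h1 h2
    rw [Finset.coe_singleton, Set.image_singleton, Set.image_singleton, Set.image_singleton]
    omega
  obtain ⟨F, -, ⟨hFP, hFne, hF⟩, hmax⟩ := hs.exists_le_maximal has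
  by_cases hFeq : F = P
  · rwa [← hFeq]
  exfalso
  obtain ⟨D, hDT, ⟨d, hd⟩, c, hc, hmem, hc0, hcard⟩ := exists_ear t F _ (hP F hFP hFne hFeq)
  have h1 := finrank_sup_add_finrank_sup_le x w F D c hc hmem hc0
  have hu : F ∪ D ∈ s := by
    refine ⟨Finset.union_subset hFP (hDT.trans Finset.sdiff_subset),
      hFne.mono Finset.subset_union_left, ?_⟩
    rw [Finset.coe_union, Set.image_union, Set.image_union, Set.image_union, Submodule.span_union,
      Submodule.span_union, Submodule.span_union]
    omega
  exact (Finset.mem_sdiff.1 (hDT hd)).2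
    (hmax hu Finset.subset_union_left (Finset.mem_union_right F hd))

lemma ConnectedOn.of_outer {x : ι → I → ℝ} {w : ι → W} {P : Finset ι}
    (hP : ConnectedOn (fun a => outer (x a) (w a)) P) : ConnectedOn w P := by
  intro F hF hne hFP hdisj
  refine hP F hF hne hFP ?_
  have key : ∀ (G : Set ι) (f : I → W),
      f ∈ Submodule.span ℝ ((fun a => outer (x a) (w a)) '' G) →
      ∀ i, f i ∈ Submodule.span ℝ (w '' G) := by
    intro G f hf i
    induction hf using Submodule.span_induction with
    | mem v hv =>
      obtain ⟨a, ha, rfl⟩ := hv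
      exact Submodule.smul_mem _ _ (Submodule.subset_span ⟨a, ha, rfl⟩)
    | zero => exact Submodule.zero_mem _
    | add u v _ _ hu hv => exact Submodule.add_mem _ hu hv
    | smul r v _ hv => exact Submodule.smul_mem _ _ hv
  rw [Submodule.disjoint_def] at hdisj ⊢
  intro f h1 h2
  ext1 i
  exact hdisj _ (key _ f h1 i) (key _ f h2 i)

lemma ConnectedOn.ne_zero {t : ι → U} {P : Finset ι} (hP : ConnectedOn t P) (h1 : 1 < P.card)
    {a : ι} (ha : a ∈ P) : t a ≠ 0 := by
  classical
  intro h0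
  refine hP {a} (by simpa using ha) (by simp) ?_ (by simp [h0])
  rintro rfl
  simp at h1

end Connected

section Matching

variable {α β ι U I J W : Type*} [AddCommGroup U] [Module ℝ U] [AddCommGroup W] [Module ℝ W]

lemma finrank_span_lt_card_of_sum_eq_zero {t : ι → U} {P : Finset ι} (hne : P.Nonempty)
    (hsum : ∑ a ∈ P, t a = 0) :
    Module.finrank ℝ (Submodule.span ℝ (t '' P)) < P.card := by
  classical
  obtain ⟨a, ha⟩ := hne
  have hmem : ∀ b ∈ P.erase a, t b ∈ Submodule.span ℝ (((P.erase a).image t : Finset U) : Set U) :=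
    fun b hb => Submodule.subset_span (Finset.mem_image_of_mem t hb)
  have hle : Submodule.span ℝ (t '' P) ≤
      Submodule.span ℝ (((P.erase a).image t : Finset U) : Set U) := by
    rw [Submodule.span_le]
    rintro _ ⟨b, hb, rfl⟩
    rcases eq_or_ne b a with rfl | hba
    · rw [← Finset.add_sum_erase P _ ha] at hsum
      rw [eq_neg_of_add_eq_zero_left hsum]
      exact Submodule.neg_mem _ (Submodule.sum_mem _ hmem)
    · exact hmem b (Finset.mem_erase.2 ⟨hba, hb⟩)
  calc _ ≤ _ := Submodule.finrank_mono hle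
    _ ≤ _ := finrank_span_finset_le_card _
    _ ≤ _ := Finset.card_image_le
    _ < _ := Finset.card_erase_lt_of_mem ha

lemma finrank_span_toLeft_le [FiniteDimensional ℝ U] (v : α ⊕ β → U) (P : Finset (α ⊕ β)) :
    Module.finrank ℝ (Submodule.span ℝ ((fun a => v (.inl a)) '' P.toLeft)) ≤
      Module.finrank ℝ (Submodule.span ℝ (v '' P)) := by
  refine Submodule.finrank_mono (Submodule.span_mono ?_)
  rintro _ ⟨a, ha, rfl⟩
  exact ⟨.inl a, Finset.mem_toLeft.1 ha, rfl⟩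

/-- In a vanishing sum of product tensors indexed by `α ⊕ β`, where the `α`-part is in general
position, the `β`-part has at least as many terms as the `α`-part; when both have equally many,
each term of the `α`-part cancels against one term of the `β`-part. -/
lemma card_toLeft_le_card_toRight [Fintype I] [Fintype J] [FiniteDimensional ℝ W]
    (x : α ⊕ β → I → ℝ) (y : α ⊕ β → J → ℝ) (z : α ⊕ β → W)
    (h0 : ∀ a, outer (x (.inl a)) (outer (y (.inl a)) (z (.inl a))) ≠ 0)
    (hgen : ∀ S : Finset α, 2 ≤ S.card → 2 * S.card + 2 ≤
      Module.finrank ℝ (Submodule.span ℝ ((fun a => x (.inl a)) '' S)) +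
      Module.finrank ℝ (Submodule.span ℝ ((fun a => y (.inl a)) '' S)) +
      Module.finrank ℝ (Submodule.span ℝ ((fun a => z (.inl a)) '' S)))
    (P : Finset (α ⊕ β)) (hP : ∑ a ∈ P, outer (x a) (outer (y a) (z a)) = 0) :
    P.toLeft.card ≤ P.toRight.card ∧ (P.toLeft.card = P.toRight.card → ∀ a ∈ P.toLeft,
      ∃ b, outer (x (.inl a)) (outer (y (.inl a)) (z (.inl a))) +
        outer (x (.inr b)) (outer (y (.inr b)) (z (.inr b))) = 0) := by
  classical
  set t : α ⊕ β → I → J → W := fun a => outer (x a) (outer (y a) (z a))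
  induction P using Finset.strongInduction with
  | H P ih =>
  by_cases hconn : ConnectedOn t P
  swap
  · obtain ⟨F, hFP, hFne, hFeq, hdisj⟩ : ∃ F ⊆ P, F.Nonempty ∧ F ≠ P ∧
        Disjoint (Submodule.span ℝ (t '' F)) (Submodule.span ℝ (t '' ↑(P \ F))) := by
      simpa [ConnectedOn, and_assoc] using hconn
    have hadd : ∑ a ∈ P \ F, t a + ∑ a ∈ F, t a = 0 := (Finset.sum_sdiff hFP).trans hP
    have hmem : ∀ G : Finset (α ⊕ β), ∑ a ∈ G, t a ∈ Submodule.span ℝ (t '' G) := fun G =>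
      Submodule.sum_mem _ fun a ha => Submodule.subset_span ⟨a, ha, rfl⟩
    have hF : ∑ a ∈ F, t a = 0 := by
      refine Submodule.disjoint_def.1 hdisj _ (hmem F) ?_
      rw [eq_neg_of_add_eq_zero_right hadd]
      exact Submodule.neg_mem _ (hmem _)
    have hG : ∑ a ∈ P \ F, t a = 0 := by rwa [hF, add_zero] at hadd
    obtain ⟨hF1, hF2⟩ := ih F (hFP.ssubset_of_ne hFeq) hF
    obtain ⟨hG1, hG2⟩ := ih (P \ F) (Finset.sdiff_ssubset hFP hFne) hG
    have hl := Finset.card_sdiff_add_card_eq_card (Finset.toLeft_subset_toLeft hFP)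
    have hr := Finset.card_sdiff_add_card_eq_card (Finset.toRight_subset_toRight hFP)
    rw [← Finset.toLeft_sdiff] at hl
    rw [← Finset.toRight_sdiff] at hr
    refine ⟨by omega, fun heq a ha => ?_⟩
    by_cases haF : a ∈ F.toLeft
    · exact hF2 (by omega) a haF
    · exact hG2 (by omega) a (by rw [Finset.toLeft_sdiff]; exact Finset.mem_sdiff.2 ⟨ha, haF⟩)
  rcases lt_or_ge P.toLeft.card P.toRight.card with hlt | hge
  · exact ⟨hlt.le, fun h => absurd h hlt.ne⟩
  have hcard := P.card_toLeft_add_card_toRight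
  have hsum : ∑ a ∈ P.toLeft, t (.inl a) + ∑ b ∈ P.toRight, t (.inr b) = 0 := by
    rw [← Finset.sum_disjSum, Finset.toLeft_disjSum_toRight]
    exact hP
  rcases Nat.lt_or_ge P.toLeft.card 2 with hl | hl
  · rcases Nat.eq_zero_or_pos P.toLeft.card with hl0 | hl1
    · rw [Finset.card_eq_zero.1 hl0]
      simp
    obtain ⟨a, ha⟩ := Finset.card_eq_one.1 (by omega : P.toLeft.card = 1)
    rcases Nat.eq_zero_or_pos P.toRight.card with hr0 | hr1
    · rw [ha, Finset.card_eq_zero.1 hr0, Finset.sum_singleton, Finset.sum_empty, add_zero] at hsum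
      exact absurd hsum (h0 a)
    obtain ⟨b, hb⟩ := Finset.card_eq_one.1 (by omega : P.toRight.card = 1)
    rw [ha, hb, Finset.sum_singleton, Finset.sum_singleton] at hsum
    rw [ha, hb]
    refine ⟨le_rfl, fun _ a' ha' => ⟨b, ?_⟩⟩
    rwa [Finset.mem_singleton.1 ha']
  exfalso
  have hne : P.Nonempty := Finset.card_pos.1 (by omega)
  have h1 := hconn.finrank_add_finrank_le hne fun a ha => hconn.ne_zero (by omega) ha
  have h2 := hconn.of_outer.finrank_add_finrank_le hne
    fun a ha => hconn.of_outer.ne_zero (by omega) ha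
  have h3 := finrank_span_lt_card_of_sum_eq_zero hne hP
  have h4 := hgen P.toLeft hl
  have hx := finrank_span_toLeft_le x P
  have hy := finrank_span_toLeft_le y P
  have hz := finrank_span_toLeft_le z P
  omega

end Matching

lemma min_kRank_card_le_finrank {α β : Type*} [Fintype α] [Fintype β] (A : Matrix α β ℝ)
    (S : Finset β) :
    min (kRank A) S.card ≤ Module.finrank ℝ (Submodule.span ℝ ((fun r i => A i r) '' S)) := by
  obtain ⟨hle, hind⟩ : kRank A ≤ Fintype.card β ∧ ∀ s : Finset β, s.card = kRank A →
      LinearIndependent ℝ fun j : s => fun i : α => A i j.1 :=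
    Nat.sSup_mem (s := {k | k ≤ Fintype.card β ∧ ∀ s : Finset β, s.card = k →
        LinearIndependent ℝ fun j : s => fun i : α => A i j.1})
      ⟨0, Nat.zero_le _, fun s hs => by
        obtain rfl := Finset.card_eq_zero.1 hs
        exact linearIndependent_empty_type⟩
      ⟨Fintype.card β, fun k hk => hk.1⟩
  obtain ⟨S', hS', hcard⟩ := Finset.exists_subset_card_eq (min_le_right (kRank A) S.card)
  obtain ⟨S'', hS'', -, hcard'⟩ := Finset.exists_subsuperset_card_eq (Finset.subset_univ S')
    (hcard.trans_le (min_le_left _ _)) hle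
  have h1 : LinearIndepOn ℝ (fun r i => A i r) (S' : Set β) :=
    LinearIndepOn.mono (hind S'' hcard') (by simpa using hS'')
  have h2 : Module.finrank ℝ (Submodule.span ℝ ((fun r i => A i r) '' (S' : Set β))) =
      Fintype.card S' := by
    rw [Set.image_eq_range]
    exact finrank_span_eq_card h1
  calc _ = S'.card := hcard.symm
    _ = _ := (h2.trans (Fintype.card_coe S')).symm
    _ ≤ _ := Submodule.finrank_mono (Submodule.span_mono (Set.image_mono (by simpa using hS')))

lemma kRank_le_card {α β : Type*} [Fintype α] [Fintype β] (A : Matrix α β ℝ) :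
    kRank A ≤ Fintype.card β :=
  csSup_le' fun _ hk => hk.1

section RankOne

variable {I J K : Type*}

lemma outer_ne_zero {W : Type*} [AddCommGroup W] [Module ℝ W] {x : I → ℝ} {w : W} (hx : x ≠ 0)
    (hw : w ≠ 0) : outer x w ≠ 0 := by
  obtain ⟨i, hi⟩ := Function.ne_iff.1 hx
  exact fun h => smul_ne_zero hi hw (congrFun h i)

lemma exists_scaling_of_outer_eq {a a' : I → ℝ} {b b' : J → ℝ} {c c' : K → ℝ}
    (h : outer a (outer b c) = outer a' (outer b' c')) (h0 : outer a (outer b c) ≠ 0) :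
    ∃ la lb lc : ℝ, la * lb * lc = 1 ∧ (∀ i, a' i = la * a i) ∧ (∀ j, b' j = lb * b j) ∧
      ∀ k, c' k = lc * c k := by
  have hE : ∀ i j k, a i * (b j * c k) = a' i * (b' j * c' k) := fun i j k =>
    congrFun (congrFun (congrFun h i) j) k
  obtain ⟨i, hi⟩ := Function.ne_iff.1 h0
  obtain ⟨j, hj⟩ := Function.ne_iff.1 hi
  obtain ⟨k, hk⟩ := Function.ne_iff.1 hj
  have hne : a i * (b j * c k) ≠ 0 := hk
  have hne' := hne
  rw [hE] at hne'
  simp only [ne_eq, mul_eq_zero, not_or] at hne hne'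
  obtain ⟨ha, hb, hc⟩ := hne
  obtain ⟨ha', hb', hc'⟩ := hne'
  have hijk := hE i j k
  refine ⟨a' i / a i, b' j / b j, c' k / c k, ?_, fun i' => ?_, fun j' => ?_, fun k' => ?_⟩
  · field_simp
    linear_combination -hijk
  · rw [div_mul_eq_mul_div, eq_div_iff ha]
    refine mul_right_cancel₀ (mul_ne_zero hb' hc') ?_
    linear_combination a i' * hijk - a i * hE i' j k
  · rw [div_mul_eq_mul_div, eq_div_iff hb]
    refine mul_right_cancel₀ (mul_ne_zero ha' hc') ?_
    linear_combination b j' * hijk - b j * hE i j' k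
  · rw [div_mul_eq_mul_div, eq_div_iff hc]
    refine mul_right_cancel₀ (mul_ne_zero ha' hb') ?_
    linear_combination c k' * hijk - c k * hE i j k'

end RankOne

section Kruskal

variable {I J K R : ℕ}

/-- The `r`-th rank-1 term of `[A, B, C]_R`. -/
def cpdTerm (A : Matrix (Fin I) (Fin R) ℝ) (B : Matrix (Fin J) (Fin R) ℝ)
    (C : Matrix (Fin K) (Fin R) ℝ) (r : Fin R) : Fin I → Fin J → Fin K → ℝ :=
  outer (fun i => A i r) (outer (fun j => B j r) fun k => C k r)

lemma cpdTensor_eq_sum_cpdTerm (A : Matrix (Fin I) (Fin R) ℝ) (B : Matrix (Fin J) (Fin R) ℝ)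
    (C : Matrix (Fin K) (Fin R) ℝ) : cpdTensor A B C = ∑ r, cpdTerm A B C r := by
  ext i j k
  simp [cpdTensor, cpdTerm, outer, mul_assoc]

lemma col_ne_zero_of_kRank_pos {A : Matrix (Fin I) (Fin R) ℝ} (hA : 0 < kRank A) (r : Fin R) :
    (fun i => A i r) ≠ 0 := by
  intro h
  have := min_kRank_card_le_finrank A {r}
  rw [Finset.coe_singleton, Set.image_singleton, h, Submodule.span_zero_singleton, finrank_bot,
    Finset.card_singleton] at this
  omega

variable {A : Matrix (Fin I) (Fin R) ℝ} {B : Matrix (Fin J) (Fin R) ℝ}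
  {C : Matrix (Fin K) (Fin R) ℝ}

lemma cpdTerm_ne_zero (hA : 0 < kRank A) (hB : 0 < kRank B) (hC : 0 < kRank C) (r : Fin R) :
    cpdTerm A B C r ≠ 0 :=
  outer_ne_zero (col_ne_zero_of_kRank_pos hA r)
    (outer_ne_zero (col_ne_zero_of_kRank_pos hB r) (col_ne_zero_of_kRank_pos hC r))

lemma cpdTerm_injective (hA : 2 ≤ kRank A) (hB : 0 < kRank B) (hC : 0 < kRank C) :
    Function.Injective (cpdTerm A B C) := by
  intro r s hrs
  by_contra hne
  obtain ⟨la, -, -, -, hla, -⟩ := exists_scaling_of_outer_eq hrs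
    (cpdTerm_ne_zero (by omega) hB hC r)
  have h1 := min_kRank_card_le_finrank A {r, s}
  have h2 : Submodule.span ℝ ((fun r i => A i r) '' ↑({r, s} : Finset (Fin R))) ≤
      Submodule.span ℝ {fun i => A i r} := by
    rw [Submodule.span_le]
    rintro _ ⟨u, hu, rfl⟩
    rcases (by simpa using hu : u = r ∨ u = s) with rfl | rfl
    · exact Submodule.mem_span_singleton_self _
    · exact Submodule.mem_span_singleton.2 ⟨la, funext fun i => (hla i).symm⟩
  have h3 := Submodule.finrank_mono h2
  rw [finrank_span_singleton (col_ne_zero_of_kRank_pos (by omega) r)] at h3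
  rw [Finset.card_pair hne] at h1
  omega

lemma le_and_forall_exists_cpdTerm_eq {R' : ℕ}
    (h : 2 * R + 2 ≤ kRank A + kRank B + kRank C) {A' : Matrix (Fin I) (Fin R') ℝ}
    {B' : Matrix (Fin J) (Fin R') ℝ} {C' : Matrix (Fin K) (Fin R') ℝ}
    (heq : cpdTensor A B C = cpdTensor A' B' C') :
    R ≤ R' ∧ (R = R' → ∀ r, ∃ s, cpdTerm A B C r = cpdTerm A' B' C' s) := by
  have hA := kRank_le_card A
  have hB := kRank_le_card B
  have hC := kRank_le_card C
  rw [Fintype.card_fin] at hA hB hC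
  have hneg : ∀ s, outer (-fun i => A' i s) (outer (fun j => B' j s) fun k => C' k s) =
      -cpdTerm A' B' C' s := fun s => by
    ext i j k
    simp [outer, cpdTerm]
  have hne : ∀ r, cpdTerm A B C r ≠ 0 := cpdTerm_ne_zero (by omega) (by omega) (by omega)
  have hgen : ∀ S : Finset (Fin R), 2 ≤ S.card → 2 * S.card + 2 ≤
      Module.finrank ℝ (Submodule.span ℝ ((fun r i => A i r) '' S)) +
      Module.finrank ℝ (Submodule.span ℝ ((fun r j => B j r) '' S)) +
      Module.finrank ℝ (Submodule.span ℝ ((fun r k => C k r) '' S)) := by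
    intro S hS
    have h1 := min_kRank_card_le_finrank A S
    have h2 := min_kRank_card_le_finrank B S
    have h3 := min_kRank_card_le_finrank C S
    have h4 := S.card_le_univ
    rw [Fintype.card_fin] at h4
    omega
  have key := card_toLeft_le_card_toRight
    (Sum.elim (fun r i => A i r) fun s => -fun i => A' i s)
    (Sum.elim (fun r j => B j r) fun s j => B' j s)
    (Sum.elim (fun r k => C k r) fun s k => C' k s)
    hne hgen Finset.univ (by
      rw [Fintype.sum_sum_type]
      simp only [Sum.elim_inl, Sum.elim_inr, hneg, Finset.sum_neg_distrib]
      rw [← cpdTensor_eq_sum_cpdTerm, ← heq, cpdTensor_eq_sum_cpdTerm]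
      exact add_neg_cancel _)
  simp only [Finset.toLeft_univ, Finset.toRight_univ, Finset.card_univ, Fintype.card_fin,
    Finset.mem_univ, forall_const, Sum.elim_inl, Sum.elim_inr, hneg] at key
  exact ⟨key.1, fun hR r => (key.2 hR r).imp fun s hs => eq_of_sub_eq_zero (by
    rw [sub_eq_add_neg]; exact hs)⟩

lemma exists_equiv_cpdTerm_eq (h : 2 * R + 2 ≤ kRank A + kRank B + kRank C)
    {A' : Matrix (Fin I) (Fin R) ℝ} {B' : Matrix (Fin J) (Fin R) ℝ}
    {C' : Matrix (Fin K) (Fin R) ℝ} (heq : cpdTensor A B C = cpdTensor A' B' C') :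
    ∃ σ : Equiv.Perm (Fin R), ∀ r, cpdTerm A B C r = cpdTerm A' B' C' (σ r) := by
  have hA := kRank_le_card A
  have hB := kRank_le_card B
  have hC := kRank_le_card C
  rw [Fintype.card_fin] at hA hB hC
  choose f hf using (le_and_forall_exists_cpdTerm_eq h heq).2 rfl
  have hinj : Function.Injective f := fun r s hrs =>
    cpdTerm_injective (A := A) (B := B) (C := C) (by omega) (by omega) (by omega)
      (by rw [hf, hf, hrs])
  exact ⟨Equiv.ofBijective f (Finite.injective_iff_bijective.1 hinj), hf⟩

end Kruskal

/-- **Kruskal's condition.** If `k_A + k_B + k_C ≥ 2R + 2`, then the rank of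
`T = [A,B,C]_R` equals `R` and the CPD of `T` is unique. -/
theorem stmt2 {I J K R : ℕ} (A : Matrix (Fin I) (Fin R) ℝ) (B : Matrix (Fin J) (Fin R) ℝ)
    (C : Matrix (Fin K) (Fin R) ℝ)
    (h : 2 * R + 2 ≤ kRank A + kRank B + kRank C) :
    tensorRank (cpdTensor A B C) = R ∧ cpdUnique R (cpdTensor A B C) := by
  refine ⟨IsLeast.csInf_eq ⟨⟨A, B, C, rfl⟩, ?_⟩, ?_⟩
  · rintro n ⟨A', B', C', heq⟩
    exact (le_and_forall_exists_cpdTerm_eq h heq).1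
  · intro A₁ A₂ B₁ B₂ C₁ C₂ h₁ h₂
    have hA := kRank_le_card A
    have hB := kRank_le_card B
    have hC := kRank_le_card C
    rw [Fintype.card_fin] at hA hB hC
    obtain ⟨σ, hσ⟩ := exists_equiv_cpdTerm_eq h h₁
    obtain ⟨τ, hτ⟩ := exists_equiv_cpdTerm_eq h h₂
    have hterm : ∀ r, cpdTerm A B C (τ.symm r) = cpdTerm A₂ B₂ C₂ r := fun r => by
      rw [hτ, Equiv.apply_symm_apply]
    have hne : ∀ r, cpdTerm A B C r ≠ 0 := cpdTerm_ne_zero (by omega) (by omega) (by omega)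
    choose la lb lc hl ha hb hc using fun r => exists_scaling_of_outer_eq
      ((hσ (τ.symm r)).symm.trans (hterm r)) ((hσ (τ.symm r)).symm.trans_ne (hne _))
    exact ⟨τ.symm.trans σ, la, lb, lc, hl, fun i r => ha r i, fun j r => hb r j,
      fun k r => hc r k⟩
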